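/- For every m≥4 the following three identities hold: (1) B((t_m+2t_{m-1}+t_{m-2}−3)/2) − B((t_m+2t_{m-1}−t_{m-2}−3)/2) = (m/22)(4t_m−9t_{m-1}+10t_{m-2}) + (1/44)(19t_m+36t_{m-1}−169t_{m-2}) − 1/4; (2) B((t_m+2t_{m-1}−t_{m-2}−3)/2) − B((−t_m+4t_{m-1}+t_{m-2}−3)/2) = (m/22)(10t_m−6t_{m-1}−19t_{m-2}) + (1/44)(−189t_m+156t_{m-1}+331t_{m-2}) − 1/4; (3) B((−t_m+4t_{m-1}+t_{m-2}−3)/2) − B((t_m+t_{m-2}−3)/2) = (m/22)(−19t_m+29t_{m-1}+13t_{m-2}) + (1/44)(237t_m−358t_{m-1}−157t_{m-2}) + 3/4. -/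

import Mathlib

/-- The three-letter alphabet of the Tribonacci word. -/
inductive TLetter : Type
  | a | b | c
deriving DecidableEq

/-- The Tribonacci substitution σ(a)=ab, σ(b)=ac, σ(c)=a. -/
def tsubst : TLetter → List TLetter
  | .a => [.a, .b]
  | .b => [.a, .c]
  | .c => [.a]

/-- `Tword m = σ^m(a)`, the m-th finite Tribonacci word. -/
def Tword : ℕ → List TLetter
  | 0 => [.a]
  | n + 1 => (Tword n).flatMap tsubst

/-- The prefix 𝕋[1,n] of the Tribonacci word of length n
(each `Tword n` is a prefix of the next and has length ≥ n). -/
def TPrefix (n : ℕ) : List TLetter := (Tword n).take n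

/-- A word is a factor of the Tribonacci word 𝕋. -/
def IsFactorT (w : List TLetter) : Prop := ∃ m, w <:+: Tword m

/-- `tribAux i = t_{i-2}`: Tribonacci numbers, shifted so that the index is a natural. -/
def tribAux : ℕ → ℕ
  | 0 => 0
  | 1 => 1
  | 2 => 1
  | n + 3 => tribAux (n + 2) + tribAux (n + 1) + tribAux n

/-- The Tribonacci numbers `t m` for `m : ℤ`: t₋₂=0, t₋₁=1, t₀=1,
`t m = t (m-1) + t (m-2) + t (m-3)` for m ≥ 1. (Junk value 0 below -2.) -/
def t (m : ℤ) : ℕ := tribAux (m + 2).toNat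

/-- Kernel numbers: k₀=0, k₁=k₂=1, `k m = k (m-1) + k (m-2) + k (m-3) - 1` for m ≥ 3. -/
def kAux : ℕ → ℕ
  | 0 => 0
  | 1 => 1
  | 2 => 1
  | n + 3 => kAux (n + 2) + kAux (n + 1) + kAux n - 1

def kker (m : ℤ) : ℕ := kAux m.toNat

/-- `A n`: the number of distinct nonempty words w with ww a factor of 𝕋[1,n]. -/
noncomputable def A (n : ℕ) : ℕ := Nat.card {w : List TLetter // w ≠ [] ∧ (w ++ w) <:+: TPrefix n}

/-- `B n`: the number of occurrences of squares in 𝕋[1,n], i.e. of pairs (w,i) with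
w nonempty, i ≥ 1, ww occurring in 𝕋 at position i and i + 2|w| - 1 ≤ n. -/
noncomputable def B (n : ℕ) : ℕ :=
  Nat.card {p : List TLetter × ℕ // p.1 ≠ [] ∧ 1 ≤ p.2 ∧
    p.2 + 2 * p.1.length - 1 ≤ n ∧ (p.1 ++ p.1) <+: (TPrefix n).drop (p.2 - 1)}

/-- `C n`: the number of distinct nonempty words w with www a factor of 𝕋[1,n]. -/
noncomputable def C (n : ℕ) : ℕ := Nat.card {w : List TLetter // w ≠ [] ∧ (w ++ w ++ w) <:+: TPrefix n}

/-- `D n`: the number of occurrences of cubes in 𝕋[1,n], i.e. of pairs (w,i) with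
w nonempty, i ≥ 1, www occurring in 𝕋 at position i and i + 3|w| - 1 ≤ n. -/
noncomputable def D (n : ℕ) : ℕ :=
  Nat.card {p : List TLetter × ℕ // p.1 ≠ [] ∧ 1 ≤ p.2 ∧
    p.2 + 3 * p.1.length - 1 ≤ n ∧ (p.1 ++ p.1 ++ p.1) <+: (TPrefix n).drop (p.2 - 1)}

namespace Tribonacci

open Finset

/-- The letter of the Tribonacci word at the (zero-based) index `k`. -/
def letter (k : ℕ) : TLetter := (Tword k).getD k .a

/-- The position at which the image of the letter of index `k` starts in `σ(𝕋) = 𝕋`. -/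
def pos : ℕ → ℕ
  | 0 => 0
  | k + 1 => pos k + (tsubst (letter k)).length

/-- The cyclic permutation a → b → c → a of the letters. -/
def rot : TLetter → TLetter
  | .a => .b
  | .b => .c
  | .c => .a

/-- The factors of length `l` of the Tribonacci word at the indices `x` and `y` agree. -/
def Matches (x y l : ℕ) : Prop := ∀ k < l, letter (x + k) = letter (y + k)

instance (x y l : ℕ) : Decidable (Matches x y l) := by unfold Matches; infer_instance

/-! ### The infinite word and its desubstitution -/

lemma Tword_eq_cons_and_lt_length (n : ℕ) :
    ∃ s, Tword n = .a :: s ∧ n ≤ s.length := by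
  induction n with
  | zero => exact ⟨[], rfl, le_rfl⟩
  | succ n ih =>
    obtain ⟨s, hs, hn⟩ := ih
    have aux : ∀ l : List TLetter, l.length ≤ (l.flatMap tsubst).length := by
      intro l
      induction l with
      | nil => simp
      | cons x l ih =>
        cases x <;> simp only [List.flatMap_cons, tsubst, List.length_append, List.length_cons,
          List.length_nil] <;> omega
    refine ⟨.b :: s.flatMap tsubst, by simp [Tword, hs, tsubst], ?_⟩
    have := aux s
    simp only [List.length_cons]
    omega

lemma lt_length_Tword (n : ℕ) : n < (Tword n).length := by
  obtain ⟨s, hs, hn⟩ := Tword_eq_cons_and_lt_length n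
  simp [hs]; omega

lemma Tword_prefix_succ (n : ℕ) : Tword n <+: Tword (n + 1) := by
  induction n with
  | zero => exact ⟨[.b], rfl⟩
  | succ n ih =>
    obtain ⟨s, hs⟩ := ih
    refine ⟨s.flatMap tsubst, ?_⟩
    conv_rhs => rw [Tword, ← hs]
    rw [List.flatMap_append, Tword]

lemma Tword_prefix {m n : ℕ} (h : m ≤ n) : Tword m <+: Tword n := by
  induction n, h using Nat.le_induction with
  | base => exact List.prefix_rfl
  | succ n _ ih => exact ih.trans (Tword_prefix_succ n)

lemma getElem?_Tword {n k : ℕ} (h : k < (Tword n).length) :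
    (Tword n)[k]? = some (letter k) := by
  have hk := lt_length_Tword k
  have h2 : (Tword k)[k]? = some (letter k) := by
    rw [letter, List.getD_eq_getElem?_getD, List.getElem?_eq_getElem hk]; rfl
  rcases le_total n k with hle | hle
  · rw [← h2]
    obtain ⟨s, hs⟩ := Tword_prefix hle
    rw [← hs, List.getElem?_append_left h]
  · rw [← h2]
    obtain ⟨s, hs⟩ := Tword_prefix hle
    rw [← hs, List.getElem?_append_left hk]

lemma length_flatMap_take_Tword (n k : ℕ) (h : k ≤ (Tword n).length) :
    (((Tword n).take k).flatMap tsubst).length = pos k := by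
  induction k with
  | zero => simp [pos]
  | succ k ih =>
    rw [List.take_add_one, List.flatMap_append, List.length_append, ih (by omega),
      getElem?_Tword (by omega)]
    simp [pos]

lemma letter_pos_add (k j : ℕ) (h : j < (tsubst (letter k)).length) :
    (tsubst (letter k))[j]? = some (letter (pos k + j)) := by
  have hk := lt_length_Tword k
  have e : Tword (k + 1) = ((Tword k).take k).flatMap tsubst ++
      (tsubst (letter k) ++ ((Tword k).drop (k + 1)).flatMap tsubst) := by
    conv_lhs => rw [Tword, ← List.take_append_drop k (Tword k), List.drop_eq_getElem_cons hk]
    have : (Tword k)[k] = letter k := by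
      have := getElem?_Tword hk
      rwa [List.getElem?_eq_getElem hk, Option.some_inj] at this
    rw [List.flatMap_append, List.flatMap_cons, this]
  have hl := length_flatMap_take_Tword k k hk.le
  have hlt : pos k + j < (Tword (k + 1)).length := by
    rw [e, List.length_append, List.length_append, hl]; omega
  rw [← getElem?_Tword hlt, e, List.getElem?_append_right (by omega),
    List.getElem?_append_left (by omega), hl]
  simp

@[simp] lemma letter_pos (k : ℕ) : letter (pos k) = .a := by
  have := letter_pos_add k 0 (by cases letter k <;> simp [tsubst])
  cases h : letter k <;> simp_all [tsubst]

lemma pos_succ_of_eq {k : ℕ} (h : letter k = .c) : pos (k + 1) = pos k + 1 := by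
  simp [pos, h, tsubst]

lemma pos_succ_of_ne {k : ℕ} (h : letter k ≠ .c) : pos (k + 1) = pos k + 2 := by
  cases h' : letter k <;> simp_all [pos, tsubst]

@[simp] lemma letter_pos_add_one (k : ℕ) : letter (pos k + 1) = rot (letter k) := by
  by_cases hc : letter k = .c
  · rw [← pos_succ_of_eq hc, letter_pos, hc]; rfl
  · have := letter_pos_add k 1 (by cases h : letter k <;> simp_all [tsubst])
    cases h : letter k <;> simp_all [tsubst, rot]

lemma rot_injective : Function.Injective rot := by
  intro x y; cases x <;> cases y <;> simp [rot]

lemma pos_strictMono : StrictMono pos := by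
  refine strictMono_nat_of_lt_succ fun k => ?_
  by_cases hc : letter k = .c
  · rw [pos_succ_of_eq hc]; omega
  · rw [pos_succ_of_ne hc]; omega

lemma exists_pos (j : ℕ) :
    ∃ k, j = pos k ∨ (j = pos k + 1 ∧ letter k ≠ .c) := by
  induction j with
  | zero => exact ⟨0, Or.inl rfl⟩
  | succ j ih =>
    obtain ⟨k, rfl | ⟨rfl, h⟩⟩ := ih
    · by_cases hc : letter k = .c
      · exact ⟨k + 1, Or.inl (pos_succ_of_eq hc).symm⟩
      · exact ⟨k, Or.inr ⟨rfl, hc⟩⟩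
    · exact ⟨k + 1, Or.inl (pos_succ_of_ne h).symm⟩

lemma exists_pos_of_letter_eq_a {j : ℕ} (h : letter j = .a) : ∃ k, j = pos k := by
  obtain ⟨k, rfl | ⟨rfl, hk⟩⟩ := exists_pos j
  · exact ⟨k, rfl⟩
  · rw [letter_pos_add_one] at h
    cases h' : letter k <;> simp_all [rot]

lemma exists_pos_add_one_of_letter_eq {j : ℕ} {z : TLetter} (hz : z ≠ .c)
    (h : letter j = rot z) : ∃ k, j = pos k + 1 ∧ letter k = z := by
  obtain ⟨k, rfl | ⟨rfl, hk⟩⟩ := exists_pos j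
  · cases z <;> simp_all [rot]
  · exact ⟨k, rfl, rot_injective (by rw [← h, letter_pos_add_one])⟩

/-- The successor of a letter other than a is a. -/
lemma letter_succ_of_ne_a {j : ℕ} (h : letter j ≠ .a) : letter (j + 1) = .a := by
  obtain ⟨k, rfl | ⟨rfl, hk⟩⟩ := exists_pos j
  · simp at h
  · rw [show pos k + 1 + 1 = pos (k + 1) from (pos_succ_of_ne hk).symm, letter_pos]

/-! ### Matching factors and the substitution -/

lemma matches_succ {x y l : ℕ} :
    Matches x y (l + 1) ↔ Matches x y l ∧ letter (x + l) = letter (y + l) :=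
  Nat.forall_lt_succ_right

lemma matches_succ_left {x y l : ℕ} :
    Matches x y (l + 1) ↔ letter x = letter y ∧ Matches (x + 1) (y + 1) l := by
  simp only [Matches, Nat.forall_lt_succ_left, add_zero]
  simp only [add_assoc, add_comm 1]

lemma Matches.pos_add {x y q : ℕ} (h : Matches x y q) :
    pos (x + q) + pos y = pos (y + q) + pos x := by
  induction q with
  | zero => simp [add_comm]
  | succ q ih =>
    obtain ⟨h, e⟩ := matches_succ.1 h
    have := ih h
    rw [← add_assoc, ← add_assoc, pos, pos, e]
    omega

lemma matches_pos_add_two_of {x y q : ℕ}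
    (H : ∀ l, pos x + l = pos (x + q) + 1 → (Matches x y q ↔ Matches (pos x) (pos y) l))
    (l : ℕ) (hl : pos x + l = pos (x + q) + 2) :
    Matches x y (q + 1) ↔ Matches (pos x) (pos y) l := by
  have hx : pos x ≤ pos (x + q) := pos_strictMono.monotone (by omega)
  obtain ⟨l, rfl⟩ : ∃ l', l = l' + 1 := ⟨l - 1, by omega⟩
  rw [matches_succ, matches_succ, ← H l (by omega)]
  refine and_congr_right fun h => ?_
  have := h.pos_add
  rw [show pos x + l = pos (x + q) + 1 by omega, show pos y + l = pos (y + q) + 1 by omega,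
    letter_pos_add_one, letter_pos_add_one, rot_injective.eq_iff]

lemma matches_pos_add_one {x y q : ℕ} : ∀ l, pos x + l = pos (x + q) + 1 →
    (Matches x y q ↔ Matches (pos x) (pos y) l) := by
  induction q with
  | zero =>
    intro l hl
    obtain rfl : l = 1 := by simpa using hl
    simp [Matches]
  | succ q ih =>
    intro l hl
    have half := matches_pos_add_two_of ih
    by_cases hc : letter (x + q) = .c
    · exact half l (by rw [hl, ← add_assoc, pos_succ_of_eq hc])
    · have e := pos_succ_of_ne hc
      rw [← add_assoc] at hl
      have hx : pos x ≤ pos (x + q) := pos_strictMono.monotone (by omega)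
      obtain ⟨l, rfl⟩ : ∃ l', l = l' + 1 := ⟨l - 1, by omega⟩
      rw [matches_succ (x := pos x), ← half l (by omega), iff_self_and]
      intro h
      have := h.pos_add
      rw [← add_assoc, ← add_assoc] at this
      rw [show pos x + l = pos (x + q + 1) by omega, show pos y + l = pos (y + q + 1) by omega,
        letter_pos, letter_pos]

lemma matches_pos_add_two {x y q : ℕ} (l : ℕ) (hl : pos x + l = pos (x + q) + 2) :
    Matches x y (q + 1) ↔ Matches (pos x) (pos y) l :=
  matches_pos_add_two_of matches_pos_add_one l hl

/-! ### Squares and almost squares in prefixes -/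

/-- The squares in the prefix of length `n`: pairs `(x, y)` such that the factor between the
indices `x` and `y` is followed by a copy of itself. -/
def squares (n : ℕ) : Finset (ℕ × ℕ) :=
  (range (n + 1) ×ˢ range (n + 1)).filter fun p =>
    p.1 < p.2 ∧ 2 * p.2 ≤ n + p.1 ∧ Matches p.1 p.2 (p.2 - p.1)

/-- The squares in the prefix of length `n` whose first letter is `z`. -/
def squaresFrom (z : TLetter) (n : ℕ) : Finset (ℕ × ℕ) :=
  (squares n).filter fun p => letter p.1 = z

/-- The squares missing their last letter `z` in the prefix of length `n`: pairs `(x, w)` such that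
the factor between the indices `x` and `w` is followed by `z` and a copy of itself, which is not
followed by `z` in the prefix. -/
def almostSquares (z : TLetter) (n : ℕ) : Finset (ℕ × ℕ) :=
  (range (n + 1) ×ˢ range (n + 1)).filter fun p =>
    p.1 ≤ p.2 ∧ 2 * p.2 + 1 ≤ n + p.1 ∧ Matches p.1 (p.2 + 1) (p.2 - p.1) ∧ letter p.2 = z ∧
      ¬ (2 * p.2 + 2 ≤ n + p.1 ∧ letter (2 * p.2 + 1 - p.1) = z)

/-- The almost squares of period one. -/
def shortAlmostSquares (z : TLetter) (n : ℕ) : Finset (ℕ × ℕ) :=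
  (almostSquares z n).filter fun p => p.1 = p.2

/-- The almost squares of period at least two. -/
def longAlmostSquares (z : TLetter) (n : ℕ) : Finset (ℕ × ℕ) :=
  (almostSquares z n).filter fun p => p.1 < p.2

lemma mem_squares {n x y : ℕ} :
    (x, y) ∈ squares n ↔ x < y ∧ 2 * y ≤ n + x ∧ Matches x y (y - x) := by
  simp only [squares, mem_filter, mem_product, mem_range, and_iff_right_iff_imp]
  omega

lemma mem_squaresFrom {z : TLetter} {n x y : ℕ} :
    (x, y) ∈ squaresFrom z n ↔ (x, y) ∈ squares n ∧ letter x = z := by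
  simp [squaresFrom]

lemma mem_almostSquares {z : TLetter} {n x w : ℕ} :
    (x, w) ∈ almostSquares z n ↔ x ≤ w ∧ 2 * w + 1 ≤ n + x ∧ Matches x (w + 1) (w - x) ∧
      letter w = z ∧ ¬ (2 * w + 2 ≤ n + x ∧ letter (2 * w + 1 - x) = z) := by
  simp only [almostSquares, mem_filter, mem_product, mem_range, and_iff_right_iff_imp]
  omega

lemma mem_shortAlmostSquares {z : TLetter} {n x w : ℕ} :
    (x, w) ∈ shortAlmostSquares z n ↔ (x, w) ∈ almostSquares z n ∧ x = w := by
  simp [shortAlmostSquares]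

lemma mem_longAlmostSquares {z : TLetter} {n x w : ℕ} :
    (x, w) ∈ longAlmostSquares z n ↔ (x, w) ∈ almostSquares z n ∧ x < w := by
  simp [longAlmostSquares]

lemma card_almostSquares (z : TLetter) (n : ℕ) :
    (almostSquares z n).card = (shortAlmostSquares z n).card + (longAlmostSquares z n).card := by
  rw [shortAlmostSquares, ← card_filter_add_card_filter_not (s := almostSquares z n)
    (fun p => p.1 = p.2), longAlmostSquares]
  congr 2
  refine filter_congr ?_
  rintro ⟨x, w⟩ h
  have := (mem_almostSquares.1 h).1
  change ¬ x = w ↔ x < w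
  omega

lemma card_squares (n : ℕ) : (squares n).card =
    (squaresFrom .a n).card + (squaresFrom .b n).card + (squaresFrom .c n).card := by
  rw [squaresFrom, squaresFrom, squaresFrom, ← card_union_of_disjoint, ← card_union_of_disjoint]
  · congr 1
    ext p
    cases h : letter p.1 <;> simp [h]
  · rw [disjoint_left]
    intro p hp
    simp only [mem_union, mem_filter] at hp ⊢
    rcases hp with hp | hp <;> simp [hp]
  · rw [disjoint_left]
    intro p hp
    simp only [mem_filter] at hp ⊢
    simp [hp]

lemma pos_two_mul_add_one_sub {x w : ℕ} (hxw : x ≤ w) (h : Matches x (w + 1) (w - x)) :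
    pos w + pos (w + 1) = pos (2 * w + 1 - x) + pos x := by
  have := h.pos_add
  rwa [show x + (w - x) = w by omega, show w + 1 + (w - x) = 2 * w + 1 - x by omega] at this

lemma pos_two_mul_sub {x y : ℕ} (hxy : x < y) (h : Matches x y (y - x)) :
    pos y + pos y = pos (2 * y - x) + pos x := by
  have := h.pos_add
  rwa [show x + (y - x) = y by omega, show y + (y - x) = 2 * y - x by omega] at this

lemma mem_squaresFrom_rot {z : TLetter} {n x y : ℕ} :
    (pos x + 1, pos y + 1) ∈ squaresFrom (rot z) (pos n + 1) ↔ (x, y) ∈ squaresFrom z n := by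
  rw [mem_squaresFrom, mem_squaresFrom, mem_squares, mem_squares, letter_pos_add_one,
    rot_injective.eq_iff]
  by_cases hxy : x < y
  swap
  · have : pos y ≤ pos x := pos_strictMono.monotone (by omega)
    constructor <;> intro h <;> omega
  have h1 := pos_strictMono hxy
  have e : Matches (pos x + 1) (pos y + 1) (pos y + 1 - (pos x + 1)) ↔ Matches x y (y - x) := by
    rw [matches_pos_add_one (x := x) (q := y - x) (pos y - pos x + 1)
      (by rw [show x + (y - x) = y by omega]; omega),
      matches_succ_left]
    simp
  rw [e]
  refine and_congr_left fun _ => ?_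
  have key : Matches x y (y - x) → (2 * (pos y + 1) ≤ pos n + 1 + (pos x + 1) ↔
      2 * y ≤ n + x) := by
    intro h
    have := pos_two_mul_sub hxy h
    have := pos_strictMono.le_iff_le (a := 2 * y - x) (b := n)
    omega
  constructor
  · rintro ⟨_, h2, h3⟩
    exact ⟨hxy, (key h3).1 h2, h3⟩
  · rintro ⟨_, h2, h3⟩
    exact ⟨by omega, (key h3).2 h2, h3⟩

lemma card_squaresFrom_rot {z : TLetter} (hz : z ≠ .c) (n : ℕ) :
    (squaresFrom (rot z) (pos n + 1)).card = (squaresFrom z n).card := by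
  refine (card_nbij (fun p => (pos p.1 + 1, pos p.2 + 1))
    (fun p => (mem_squaresFrom_rot).2) ?_ ?_).symm
  · rintro ⟨x, y⟩ - ⟨x', y'⟩ - h
    simp only [Prod.mk.injEq, add_left_inj, pos_strictMono.injective.eq_iff] at h
    rw [h.1, h.2]
  · rintro ⟨x, y⟩ hxy'
    have h := mem_coe.1 hxy'
    rw [mem_squaresFrom, mem_squares] at h
    obtain ⟨⟨hxy, -, h⟩, hx⟩ := h
    obtain ⟨i, rfl, hi⟩ := exists_pos_add_one_of_letter_eq hz hx
    have := h 0 (by omega)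
    simp only [add_zero] at this
    obtain ⟨j, rfl, hj⟩ := exists_pos_add_one_of_letter_eq hz (this ▸ hx)
    exact ⟨(i, j), (mem_squaresFrom_rot).1 hxy', rfl⟩

lemma mem_longAlmostSquares_rot {z : TLetter} (hz : z ≠ .c) {n x w : ℕ} :
    (pos x, pos w + 1) ∈ longAlmostSquares (rot z) (pos n + 1) ↔ (x, w) ∈ almostSquares z n := by
  rw [mem_longAlmostSquares, mem_almostSquares, mem_almostSquares, letter_pos_add_one,
    rot_injective.eq_iff]
  by_cases hw : letter w = z
  swap
  · simp [hw]
  by_cases hxw : x ≤ w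
  swap
  · have : pos w < pos x := pos_strictMono (by omega)
    constructor <;> intro h <;> omega
  have h1 : pos x ≤ pos w := pos_strictMono.monotone hxw
  have hy : pos (w + 1) = pos w + 2 := pos_succ_of_ne (hw ▸ hz)
  have e : Matches (pos x) (pos w + 1 + 1) (pos w + 1 - pos x) ↔ Matches x (w + 1) (w - x) := by
    rw [matches_pos_add_one (x := x) (q := w - x) (pos w + 1 - pos x)
      (by rw [show x + (w - x) = w by omega]; omega), hy]
  rw [e]
  by_cases h : Matches x (w + 1) (w - x)
  swap
  · simp [h]
  have h2 := pos_two_mul_add_one_sub hxw h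
  have h3 := pos_strictMono.le_iff_le (a := 2 * w + 1 - x) (b := n)
  have h4 := pos_strictMono.lt_iff_lt (a := 2 * w + 1 - x) (b := n)
  have h5 : letter (2 * (pos w + 1) + 1 - pos x) = rot z ↔ letter (2 * w + 1 - x) = z := by
    rw [show 2 * (pos w + 1) + 1 - pos x = pos (2 * w + 1 - x) + 1 by omega, letter_pos_add_one,
      rot_injective.eq_iff]
  have h6 : 2 * (pos w + 1) + 1 ≤ pos n + 1 + pos x ↔ 2 * w + 1 ≤ n + x := by omega
  have h7 : 2 * (pos w + 1) + 2 ≤ pos n + 1 + pos x ↔ 2 * w + 2 ≤ n + x := by omega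
  rw [h5, h6, h7]
  have h8 : pos x ≤ pos w + 1 := by omega
  have h9 : pos x < pos w + 1 := by omega
  simp only [h8, h9, hxw, hw, true_and, and_true]

lemma card_longAlmostSquares_rot {z : TLetter} (hz : z ≠ .c) (n : ℕ) :
    (longAlmostSquares (rot z) (pos n + 1)).card = (almostSquares z n).card := by
  refine (card_nbij (fun p => (pos p.1, pos p.2 + 1))
    (fun p => (mem_longAlmostSquares_rot hz).2) ?_ ?_).symm
  · rintro ⟨x, y⟩ - ⟨x', y'⟩ - h
    simp only [Prod.mk.injEq, add_left_inj, pos_strictMono.injective.eq_iff] at h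
    rw [h.1, h.2]
  · rintro ⟨x, y⟩ hxy'
    have h := mem_coe.1 hxy'
    rw [mem_longAlmostSquares, mem_almostSquares] at h
    obtain ⟨⟨-, -, h, hy, -⟩, hxy⟩ := h
    obtain ⟨w, rfl, hw⟩ := exists_pos_add_one_of_letter_eq hz hy
    have := h 0 (by omega)
    simp only [add_zero] at this
    rw [show pos w + 1 + 1 = pos (w + 1) from (pos_succ_of_ne (hw ▸ hz)).symm, letter_pos] at this
    obtain ⟨i, rfl⟩ := exists_pos_of_letter_eq_a this
    exact ⟨(i, w), (mem_longAlmostSquares_rot hz).1 hxy', rfl⟩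

lemma mem_longAlmostSquares_a {n x w : ℕ} (hw : letter w = .c) :
    (pos x + 1, pos (w + 1)) ∈ longAlmostSquares .a (pos n + 1) ↔
      (x, w) ∈ longAlmostSquares .c n := by
  rw [mem_longAlmostSquares, mem_longAlmostSquares, mem_almostSquares, mem_almostSquares,
    letter_pos]
  have hy : pos (w + 1) = pos w + 1 := pos_succ_of_eq hw
  by_cases hxw : x < w
  swap
  · have : pos w ≤ pos x := pos_strictMono.monotone (by omega)
    constructor <;> intro h <;> omega
  have h1 : pos x < pos w := pos_strictMono hxw
  have e : Matches (pos x + 1) (pos (w + 1) + 1) (pos (w + 1) - (pos x + 1)) ↔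
      Matches x (w + 1) (w - x) := by
    rw [matches_pos_add_one (x := x) (q := w - x) (pos w + 1 - pos x)
      (by rw [show x + (w - x) = w by omega]; omega),
      show pos w + 1 - pos x = pos (w + 1) - (pos x + 1) + 1 by omega, matches_succ_left]
    simp
  rw [e]
  by_cases h : Matches x (w + 1) (w - x)
  swap
  · simp [h]
  have h2 := pos_two_mul_add_one_sub hxw.le h
  have h3 := pos_strictMono.le_iff_le (a := 2 * w + 1 - x) (b := n)
  have h4 := pos_strictMono.lt_iff_lt (a := 2 * w + 1 - x) (b := n)
  have h5 : letter (2 * pos (w + 1) + 1 - (pos x + 1)) = .a ↔ letter (2 * w + 1 - x) = .c := by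
    rw [show 2 * pos (w + 1) + 1 - (pos x + 1) = pos (2 * w + 1 - x) + 1 by omega,
      letter_pos_add_one]
    cases letter (2 * w + 1 - x) <;> simp [rot]
  have h6 : 2 * pos (w + 1) + 1 ≤ pos n + 1 + (pos x + 1) ↔ 2 * w + 1 ≤ n + x := by omega
  have h7 : 2 * pos (w + 1) + 2 ≤ pos n + 1 + (pos x + 1) ↔ 2 * w + 2 ≤ n + x := by omega
  rw [h5, h6, h7]
  have h8 : pos x + 1 ≤ pos (w + 1) := by omega
  have h9 : pos x + 1 < pos (w + 1) := by omega
  simp only [h8, h9, hxw, hxw.le, hw, true_and, and_true]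

/-- The word aaa does not occur in 𝕋. -/
lemma letter_add_two_ne_a {j : ℕ} (h : letter j = .a) (h' : letter (j + 1) = .a) :
    letter (j + 2) ≠ .a := by
  intro h''
  obtain ⟨k, rfl⟩ := exists_pos_of_letter_eq_a h
  have e : ∀ i, letter (pos i + 1) = .a → letter i = .c := by
    intro i hi
    rw [letter_pos_add_one] at hi
    cases hk : letter i <;> simp_all [rot]
  have hk := e k h'
  have hk' := e (k + 1) (by rw [pos_succ_of_eq hk]; exact h'')
  rw [letter_succ_of_ne_a (by simp [hk])] at hk'
  cases hk'

lemma card_longAlmostSquares_a (n : ℕ) :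
    (longAlmostSquares .a (pos n + 1)).card = (longAlmostSquares .c n).card := by
  refine (card_nbij (fun p => (pos p.1 + 1, pos (p.2 + 1))) ?_ ?_ ?_).symm
  · rintro ⟨x, w⟩ h
    exact (mem_longAlmostSquares_a (mem_almostSquares.1 (mem_longAlmostSquares.1 h).1).2.2.2.1).2 h
  · rintro ⟨x, y⟩ - ⟨x', y'⟩ - h
    simp only [Prod.mk.injEq, add_left_inj, pos_strictMono.injective.eq_iff] at h
    rw [h.1, h.2]
  · rintro ⟨x, y⟩ hxy'
    have h := mem_coe.1 hxy'
    rw [mem_longAlmostSquares, mem_almostSquares] at h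
    obtain ⟨⟨-, hn, h, hy, hlast⟩, hxy⟩ := h
    have hu : letter (2 * y - x) = .a := by
      by_contra hu
      have hs := letter_succ_of_ne_a hu
      rw [show 2 * y - x + 1 = 2 * y + 1 - x by omega] at hs
      rw [show 2 * y - x = pos n by grind] at hu
      simp at hu
    have hl := h (y - x - 1) (by omega)
    rw [show y + 1 + (y - x - 1) = 2 * y - x by omega, hu] at hl
    obtain ⟨w, hw⟩ := exists_pos_of_letter_eq_a hl
    obtain rfl : y = pos w + 1 := by omega
    have hwc : letter w = .c := by
      rw [letter_pos_add_one] at hy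
      cases hk : letter w <;> simp_all [rot]
    have h0 := h 0 (by omega)
    have hx : letter x ≠ .a := h0 ▸ letter_add_two_ne_a (letter_pos w) hy
    obtain ⟨i, rfl | ⟨rfl, -⟩⟩ := exists_pos x
    · simp at hx
    · rw [← pos_succ_of_eq hwc] at hxy' ⊢
      exact ⟨(i, w), (mem_longAlmostSquares_a hwc).1 hxy', rfl⟩

lemma mem_squaresFrom_a {n x w : ℕ} : (pos x, pos (w + 1)) ∈ squaresFrom .a (pos n + 1) ↔
    (x, w + 1) ∈ squares n ∨ (x, w) ∈ almostSquares .c n := by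
  rw [mem_squaresFrom, mem_squares, mem_squares, mem_almostSquares, letter_pos]
  by_cases hxw : x ≤ w
  swap
  · have : pos (w + 1) ≤ pos x := pos_strictMono.monotone (by omega)
    constructor <;> intro h <;> omega
  have h1 : pos x < pos (w + 1) := pos_strictMono (by omega)
  have h1' : pos x ≤ pos w := pos_strictMono.monotone hxw
  have hm : Matches x (w + 1) (w + 1 - x) ↔
      Matches x (w + 1) (w - x) ∧ letter w = letter (2 * w + 1 - x) := by
    rw [show w + 1 - x = w - x + 1 by omega, matches_succ, show x + (w - x) = w by omega,
      show w + 1 + (w - x) = 2 * w + 1 - x by omega]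
  have h3 := pos_strictMono.le_iff_le (a := 2 * w + 1 - x) (b := n)
  have h4 := pos_strictMono.lt_iff_lt (a := 2 * w + 1 - x) (b := n)
  by_cases hw : letter w = .c
  · have hy := pos_succ_of_eq hw
    have e : Matches (pos x) (pos (w + 1)) (pos (w + 1) - pos x) ↔ Matches x (w + 1) (w - x) :=
      (matches_pos_add_one _ (by rw [show x + (w - x) = w by omega]; omega)).symm
    rw [e, hm]
    by_cases h : Matches x (w + 1) (w - x)
    swap
    · simp [h]
    have h2 := pos_two_mul_add_one_sub hxw h
    grind
  · have hy := pos_succ_of_ne hw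
    have e : Matches (pos x) (pos (w + 1)) (pos (w + 1) - pos x) ↔
        Matches x (w + 1) (w + 1 - x) := by
      rw [show w + 1 - x = w - x + 1 by omega]
      exact (matches_pos_add_two _ (by rw [show x + (w - x) = w by omega]; omega)).symm
    rw [e]
    by_cases h : Matches x (w + 1) (w + 1 - x)
    swap
    · simp [h, hw]
    have h' := hm.1 h
    have h2 := pos_two_mul_add_one_sub hxw h'.1
    have h5 : pos (2 * w + 1 - x + 1) = pos (2 * w + 1 - x) + 2 := pos_succ_of_ne (h'.2 ▸ hw)
    have h6 := pos_two_mul_sub (by omega) h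
    simp only [h, hw, h1, false_and, and_false, or_false, true_and, and_true]
    omega

lemma card_squaresFrom_a (n : ℕ) : (squaresFrom .a (pos n + 1)).card =
    (squares n).card + (almostSquares .c n).card := by
  have hinj : Function.Injective fun p : ℕ × ℕ => (p.1, p.2 + 1) := by
    rintro ⟨x, y⟩ ⟨x', y'⟩ h
    simpa using h
  rw [← card_image_of_injective (almostSquares .c n) hinj, ← card_union_of_disjoint]
  · refine (card_nbij (fun p => (pos p.1, pos p.2)) ?_ ?_ ?_).symm
    · rintro ⟨x, y⟩ h
      rcases mem_union.1 h with h | h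
      · obtain ⟨w, rfl⟩ : ∃ w, y = w + 1 := ⟨y - 1, by have := (mem_squares.1 h).1; omega⟩
        exact mem_squaresFrom_a.2 (Or.inl h)
      · obtain ⟨⟨x', w⟩, hm, e⟩ := mem_image.1 h
        cases e
        exact mem_squaresFrom_a.2 (Or.inr hm)
    · rintro ⟨x, y⟩ - ⟨x', y'⟩ - h
      simp only [Prod.mk.injEq, pos_strictMono.injective.eq_iff] at h
      rw [h.1, h.2]
    · rintro ⟨x, y⟩ hxy'
      have h := mem_coe.1 hxy'
      rw [mem_squaresFrom, mem_squares] at h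
      obtain ⟨⟨hxy, -, h⟩, hx⟩ := h
      have := h 0 (by omega)
      simp only [add_zero] at this
      obtain ⟨i, rfl⟩ := exists_pos_of_letter_eq_a hx
      obtain ⟨j, rfl⟩ := exists_pos_of_letter_eq_a (this ▸ hx)
      obtain ⟨w, rfl⟩ : ∃ w, j = w + 1 :=
        ⟨j - 1, by have := pos_strictMono.lt_iff_lt.1 hxy; omega⟩
      refine ⟨(i, w + 1), ?_, rfl⟩
      simpa using mem_squaresFrom_a.1 hxy'
  · rw [disjoint_left]
    rintro ⟨x, y⟩ h h'
    obtain ⟨⟨x', w⟩, hm, e⟩ := mem_image.1 h'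
    obtain ⟨rfl, rfl⟩ := Prod.mk.inj e
    rw [mem_squares] at h
    rw [mem_almostSquares] at hm
    have := h.2.2 (w - x') (by omega)
    rw [show x' + (w - x') = w by omega, show w + 1 + (w - x') = 2 * w + 1 - x' by omega] at this
    exact hm.2.2.2.2 ⟨by omega, this ▸ hm.2.2.2.1⟩

/-! ### Counting letters -/

/-- The number of occurrences of the letter `z` in the prefix of length `n`. -/
def letterCount (z : TLetter) (n : ℕ) : ℕ := Nat.count (fun k => letter k = z) n

lemma letterCount_succ (z : TLetter) (n : ℕ) :
    letterCount z (n + 1) = letterCount z n + if letter n = z then 1 else 0 :=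
  Nat.count_succ _ _

lemma letterCount_add (n : ℕ) :
    letterCount .a n + letterCount .b n + letterCount .c n = n := by
  induction n with
  | zero => rfl
  | succ n ih =>
    simp only [letterCount_succ]
    cases letter n <;> simp <;> omega

lemma letterCount_pos (n : ℕ) : letterCount .a (pos n) = n ∧
    letterCount .b (pos n) = letterCount .a n ∧ letterCount .c (pos n) = letterCount .b n := by
  induction n with
  | zero => exact ⟨rfl, rfl, rfl⟩
  | succ n ih =>
    obtain ⟨h1, h2, h3⟩ := ih
    by_cases hc : letter n = .c
    · rw [pos_succ_of_eq hc]
      simp [letterCount_succ, h1, h2, h3, hc]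
    · rw [pos_succ_of_ne hc, show pos n + 2 = pos n + 1 + 1 from rfl]
      cases h : letter n <;> simp_all [letterCount_succ, rot]

lemma letterCount_pos_add_one (n : ℕ) : letterCount .a (pos n + 1) = n + 1 ∧
    letterCount .b (pos n + 1) = letterCount .a n ∧
    letterCount .c (pos n + 1) = letterCount .b n := by
  simp [letterCount_succ, letterCount_pos]

lemma mem_shortAlmostSquares_self {z : TLetter} {n x : ℕ} : (x, x) ∈ shortAlmostSquares z n ↔
    x < n ∧ letter x = z ∧ ¬ (x + 2 ≤ n ∧ letter (x + 1) = z) := by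
  rw [mem_shortAlmostSquares, mem_almostSquares, show 2 * x + 1 - x = x + 1 by omega]
  have h1 : 2 * x + 1 ≤ n + x ↔ x < n := by omega
  have h2 : 2 * x + 2 ≤ n + x ↔ x + 2 ≤ n := by omega
  simp [h1, h2, Matches]

lemma card_shortAlmostSquares {z : TLetter} (hz : z ≠ .a) (n : ℕ) :
    (shortAlmostSquares z n).card = letterCount z n := by
  rw [letterCount, Nat.count_eq_card_filter_range]
  refine (card_nbij (fun x => (x, x)) ?_ ?_ ?_).symm
  · intro x hx
    obtain ⟨hx, h⟩ := mem_filter.1 hx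
    refine mem_shortAlmostSquares_self.2 ⟨mem_range.1 hx, h, fun h' => ?_⟩
    rw [letter_succ_of_ne_a (h ▸ hz)] at h'
    exact hz h'.2.symm
  · intro x _ y _ h
    exact (Prod.mk.inj h).1
  · rintro ⟨x, y⟩ h
    obtain rfl := (mem_shortAlmostSquares.1 h).2
    have := mem_shortAlmostSquares_self.1 h
    exact ⟨x, by simp [this], rfl⟩

lemma card_shortAlmostSquares_a (n : ℕ) :
    (shortAlmostSquares .a (pos n + 1)).card + letterCount .c n = n + 1 := by
  have e : letterCount .c n =
      ((range (n + 1)).filter fun k => k < n ∧ letter k = .c).card := by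
    rw [letterCount, Nat.count_eq_card_filter_range]
    congr 1
    ext k
    simp only [mem_filter, mem_range]
    exact ⟨fun h => ⟨by omega, h⟩, fun h => h.2⟩
  have e' : (shortAlmostSquares .a (pos n + 1)).card =
      ((range (n + 1)).filter fun k => ¬ (k < n ∧ letter k = .c)).card := by
    have key : ∀ k, (pos k, pos k) ∈ shortAlmostSquares .a (pos n + 1) ↔
        k < n + 1 ∧ ¬ (k < n ∧ letter k = .c) := by
      intro k
      have h1 := pos_strictMono.le_iff_le (a := k) (b := n)
      have h2 := pos_strictMono.lt_iff_lt (a := k) (b := n)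
      have h3 : rot (letter k) = .a ↔ letter k = .c := by cases letter k <;> simp [rot]
      rw [mem_shortAlmostSquares_self, letter_pos, letter_pos_add_one, h3]
      have h4 : pos k < pos n + 1 ↔ k < n + 1 := by omega
      have h5 : pos k + 2 ≤ pos n + 1 ↔ k < n := by omega
      simp [h4, h5]
    refine (card_nbij (fun k => (pos k, pos k)) ?_ ?_ ?_).symm
    · intro k hk
      exact (key k).2 (by simpa using hk)
    · intro x _ y _ h
      exact pos_strictMono.injective (Prod.mk.inj h).1
    · rintro ⟨x, y⟩ h
      obtain rfl := (mem_shortAlmostSquares.1 h).2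
      obtain ⟨k, rfl⟩ := exists_pos_of_letter_eq_a (mem_shortAlmostSquares_self.1 h).2.1
      exact ⟨k, by simpa using (key k).1 h, rfl⟩
  rw [e, e', add_comm, card_filter_add_card_filter_not, card_range]

/-! ### Occurrences of squares as pairs of indices -/

lemma length_TPrefix (n : ℕ) : (TPrefix n).length = n := by
  rw [TPrefix, List.length_take]
  exact min_eq_left (lt_length_Tword n).le

lemma getElem?_TPrefix {n k : ℕ} (h : k < n) : (TPrefix n)[k]? = some (letter k) := by
  rw [TPrefix, List.getElem?_take_of_lt h, getElem?_Tword (h.trans (lt_length_Tword n))]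

lemma append_self_prefix_drop_iff {w : List TLetter} {n i : ℕ} (h : i + 2 * w.length ≤ n) :
    (w ++ w) <+: (TPrefix n).drop i ↔
      w = ((TPrefix n).drop i).take w.length ∧ Matches i (i + w.length) w.length := by
  set D := (TPrefix n).drop i with hD
  have hlen : D.length = n - i := by rw [hD, List.length_drop, length_TPrefix]
  have hget : ∀ k < 2 * w.length, D[k]? = some (letter (i + k)) := by
    intro k hk
    rw [hD, List.getElem?_drop, getElem?_TPrefix (by omega)]
  constructor
  · rintro ⟨s, hs⟩
    refine ⟨by rw [← hs]; simp, fun k hk => ?_⟩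
    have h1 := hget k (by omega)
    have h2 := hget (w.length + k) (by omega)
    rw [← hs, List.append_assoc, List.getElem?_append_left hk] at h1
    rw [← hs, List.append_assoc, List.getElem?_append_right (by omega),
      List.getElem?_append_left (by omega), Nat.add_sub_cancel_left, h1, Option.some_inj] at h2
    rw [h2, add_assoc]
  · rintro ⟨hw, hm⟩
    rw [List.prefix_iff_eq_take]
    apply List.ext_getElem?
    intro k
    rw [List.length_append]
    by_cases hk : k < w.length + w.length
    swap
    · rw [List.getElem?_eq_none (by simp; omega), List.getElem?_eq_none (by simp; omega)]
    have hwk : ∀ k < w.length, w[k]? = some (letter (i + k)) := by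
      intro k hk
      rw [hw, List.getElem?_take_of_lt hk, hget k (by omega)]
    rw [List.getElem?_take_of_lt hk, hget k (by omega)]
    by_cases hk' : k < w.length
    · rw [List.getElem?_append_left hk', hwk k hk']
    · rw [List.getElem?_append_right (by omega), hwk _ (by omega), hm _ (by omega)]
      congr 2
      omega

lemma B_eq_card_squares (n : ℕ) : B n = (squares n).card := by
  rw [B, ← Nat.card_eq_finsetCard]
  refine Nat.card_eq_of_bijective (fun p => ⟨(p.1.2 - 1, p.1.2 - 1 + p.1.1.length), ?_⟩) ⟨?_, ?_⟩
  · obtain ⟨⟨w, i⟩, hw, hi, hn, h⟩ := p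
    replace hi : 1 ≤ i := hi
    replace hn : i + 2 * w.length - 1 ≤ n := hn
    have : 0 < w.length := List.length_pos_iff.2 hw
    change (i - 1, i - 1 + w.length) ∈ squares n
    rw [mem_squares, Nat.add_sub_cancel_left]
    refine ⟨by omega, by omega, ?_⟩
    exact ((append_self_prefix_drop_iff (w := w) (i := i - 1) (by omega)).1 h).2
  · rintro ⟨⟨w, i⟩, hw, hi, hn, h⟩ ⟨⟨w', i'⟩, hw', hi', hn', h'⟩ e
    simp only [Subtype.mk.injEq, Prod.mk.injEq] at e
    replace hi : 1 ≤ i := hi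
    replace hi' : 1 ≤ i' := hi'
    replace hn : i + 2 * w.length - 1 ≤ n := hn
    replace hn' : i' + 2 * w'.length - 1 ≤ n := hn'
    have hii : i = i' := by omega
    subst hii
    have hl : w.length = w'.length := by omega
    have e1 := ((append_self_prefix_drop_iff (w := w) (i := i - 1) (by omega)).1 h).1
    have e2 := ((append_self_prefix_drop_iff (w := w') (i := i - 1) (by omega)).1 h').1
    rw [← hl, ← e1] at e2
    simp [e2]
  · rintro ⟨⟨x, y⟩, h⟩
    have hm := mem_squares.1 h
    set w := ((TPrefix n).drop x).take (y - x) with hw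
    have hl : w.length = y - x := by
      rw [hw, List.length_take, List.length_drop, length_TPrefix]
      omega
    refine ⟨⟨(w, x + 1), ?_, ?_, ?_, ?_⟩, ?_⟩
    · rw [← List.length_pos_iff, hl]
      omega
    · simp
    · dsimp only
      omega
    · dsimp only
      rw [Nat.add_sub_cancel, append_self_prefix_drop_iff (by omega), hl,
        show x + (y - x) = y by omega]
      exact ⟨hw, hm.2.2⟩
    · simp only [Subtype.mk.injEq, Prod.mk.injEq]
      omega

/-! ### The linear recursion along the orbits of `next` -/

/-- The length of the prefix `σ(𝕋[1,n])a`. -/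
def next (n : ℕ) : ℕ := pos n + 1

lemma next_next_next (n : ℕ) : next (next (next n)) = next (next n) + next n + n + 3 := by
  obtain ⟨h1, h2, h3⟩ := letterCount_pos_add_one (next (next n))
  obtain ⟨h4, h5, -⟩ := letterCount_pos_add_one (next n)
  obtain ⟨h6, -⟩ := letterCount_pos_add_one n
  have := letterCount_add (next (next (next n)))
  rw [← next] at *
  omega

lemma two_mul_iterate_next_seven_add_three : ∀ k : ℕ,
    2 * next^[k] 7 + 3 = tribAux (k + 5) + 2 * tribAux (k + 4) + tribAux (k + 3)
  | 0 => by decide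
  | 1 => by decide
  | 2 => by decide
  | k + 3 => by
    have h0 := two_mul_iterate_next_seven_add_three k
    have h1 := two_mul_iterate_next_seven_add_three (k + 1)
    have h2 := two_mul_iterate_next_seven_add_three (k + 2)
    have h := next_next_next (next^[k] 7)
    have e : ∀ n, tribAux (n + 3) = tribAux (n + 2) + tribAux (n + 1) + tribAux n := fun n => rfl
    have e1 := e (k + 5)
    have e2 := e (k + 4)
    have e3 := e (k + 3)
    simp only [← Function.iterate_succ_apply' next] at h
    simp only [Nat.succ_eq_add_one, add_assoc, Nat.reduceAdd] at *
    omega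

/-- The total number of long almost squares. -/
def longCount (n : ℕ) : ℕ :=
  (longAlmostSquares .a n).card + (longAlmostSquares .b n).card + (longAlmostSquares .c n).card

/-- The number of squares starting with a or b and of long almost squares with letter c. -/
def mixedCount (n : ℕ) : ℕ :=
  (squaresFrom .a n).card + (squaresFrom .b n).card + (longAlmostSquares .c n).card

/-- The number of squares starting with a and of long almost squares with letter b or c. -/
def mixedCount' (n : ℕ) : ℕ :=
  (squaresFrom .a n).card + (longAlmostSquares .b n).card + (longAlmostSquares .c n).card

lemma letterCount_a_next (n : ℕ) : letterCount .a (next n) =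
    letterCount .a n + letterCount .b n + letterCount .c n + 1 := by
  rw [letterCount_add]
  exact (letterCount_pos_add_one n).1

lemma letterCount_b_next (n : ℕ) : letterCount .b (next n) = letterCount .a n :=
  (letterCount_pos_add_one n).2.1

lemma letterCount_c_next (n : ℕ) : letterCount .c (next n) = letterCount .b n :=
  (letterCount_pos_add_one n).2.2

lemma card_shortAlmostSquares_a_next (n : ℕ) :
    (shortAlmostSquares .a (next n)).card = letterCount .a n + letterCount .b n + 1 := by
  have h := card_shortAlmostSquares_a n
  have := letterCount_add n
  rw [← next] at h
  omega

lemma longCount_next (n : ℕ) : longCount (next n) =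
    longCount n + letterCount .b n + (shortAlmostSquares .a n).card := by
  have h := card_longAlmostSquares_a n
  have hb := card_longAlmostSquares_rot (z := .a) (by decide) n
  have hc := card_longAlmostSquares_rot (z := .b) (by decide) n
  rw [card_almostSquares] at hb hc
  rw [card_shortAlmostSquares (by decide)] at hc
  rw [← next] at h hb hc
  simp only [rot] at hb hc
  simp only [longCount]
  omega

lemma card_squares_next (n : ℕ) : (squares (next n)).card =
    (squares n).card + mixedCount n + letterCount .c n := by
  have h := card_squaresFrom_a n
  have hb := card_squaresFrom_rot (z := .a) (by decide) n
  have hc := card_squaresFrom_rot (z := .b) (by decide) n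
  rw [card_almostSquares, card_shortAlmostSquares (by decide)] at h
  rw [← next] at h hb hc
  simp only [rot] at hb hc
  rw [card_squares (next n), mixedCount]
  omega

lemma mixedCount_next (n : ℕ) : mixedCount (next n) =
    (squares n).card + mixedCount' n + letterCount .c n + letterCount .b n := by
  have h := card_squaresFrom_a n
  have hb := card_squaresFrom_rot (z := .a) (by decide) n
  have hc := card_longAlmostSquares_rot (z := .b) (by decide) n
  rw [card_almostSquares, card_shortAlmostSquares (by decide)] at h hc
  rw [← next] at h hb hc
  simp only [rot] at hb hc
  rw [mixedCount, mixedCount']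
  omega

lemma mixedCount'_next (n : ℕ) : mixedCount' (next n) = (squares n).card + longCount n +
    letterCount .c n + letterCount .b n + (shortAlmostSquares .a n).card := by
  have h := card_squaresFrom_a n
  have hb := card_longAlmostSquares_rot (z := .a) (by decide) n
  have hc := card_longAlmostSquares_rot (z := .b) (by decide) n
  rw [card_almostSquares, card_shortAlmostSquares (by decide)] at h hc
  rw [card_almostSquares] at hb
  rw [← next] at h hb hc
  simp only [rot] at hb hc
  rw [longCount, mixedCount']
  omega

/-- Closed forms, in terms of consecutive Tribonacci numbers `x`, `y`, `z` and an index `m`, for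
the differences of all the counts between the prefixes of length `p` and `q`. The parameters `e`,
`α`, `β`, `γ` are constant along the orbits of `next`. -/
structure DiffFormula (e α β γ m x y z : ℚ) (p q : ℕ) : Prop where
  a : (letterCount .a p : ℚ) - letterCount .a q = x - y - z
  b : (letterCount .b p : ℚ) - letterCount .b q = -x + 2 * y
  c : (letterCount .c p : ℚ) - letterCount .c q = -y + 2 * z
  short : ((shortAlmostSquares .a p).card : ℚ) - (shortAlmostSquares .a q).card =
    -x + y + 2 * z
  long : (longCount p : ℚ) - longCount q = (3 * x - 4 * y - z) / 2 + e
  squares : ((squares p).card : ℚ) - (squares q).card =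
    m / 22 * (4 * x - 9 * y + 10 * z) + (19 * x + 36 * y - 169 * z) / 44 - e / 2 +
      (α * x + β * y + γ * z)
  mixed : (mixedCount p : ℚ) - mixedCount q =
    m / 22 * (-9 * x + 23 * y - 6 * z) + (13 * x - 57 * y + 54 * z) / 22 +
      (β * x + (α + γ - β) * y + (α - γ) * z)
  mixed' : (mixedCount' p : ℚ) - mixedCount' q =
    m / 22 * (10 * x - 6 * y - 19 * z) + (-35 * x + 24 * y + 89 * z) / 44 + e / 2 +
      (α * y + β * z + γ * (x - y - z))

lemma DiffFormula.next {e α β γ m x y z : ℚ} {p q : ℕ} (h : DiffFormula e α β γ m x y z p q) :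
    DiffFormula e α β γ (m + 1) (x + y + z) x y (next p) (next q) where
  a := by
    simp only [letterCount_a_next]; push_cast
    linear_combination h.a + h.b + h.c
  b := by
    simp only [letterCount_b_next]
    linear_combination h.a
  c := by
    simp only [letterCount_c_next]
    linear_combination h.b
  short := by
    simp only [card_shortAlmostSquares_a_next]; push_cast
    linear_combination h.a + h.b
  long := by
    simp only [longCount_next]; push_cast
    linear_combination h.long + h.b + h.short
  squares := by
    simp only [card_squares_next]; push_cast
    linear_combination h.squares + h.mixed + h.c
  mixed := by
    simp only [mixedCount_next]; push_cast
    linear_combination h.squares + h.c + h.b + h.mixed'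
  mixed' := by
    simp only [mixedCount'_next]; push_cast
    linear_combination h.squares + h.c + h.b + h.short + h.long

lemma DiffFormula.eq_add {e α β γ m x y : ℚ} {z p q : ℕ}
    (h : DiffFormula e α β γ m x y z p q) : p = q + z := by
  have hp := letterCount_add p
  have hq := letterCount_add q
  rw [← @Nat.cast_inj ℚ] at hp hq ⊢
  push_cast at hp hq ⊢
  linear_combination h.a + h.b + h.c - hp + hq

lemma DiffFormula.iterate {e α β γ : ℚ} {m p q : ℕ}
    (h : DiffFormula e α β γ m (tribAux (m + 2)) (tribAux (m + 1)) (tribAux m) p q) (k : ℕ) :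
    DiffFormula e α β γ ↑(m + k) (tribAux (m + k + 2)) (tribAux (m + k + 1)) (tribAux (m + k))
      (Tribonacci.next^[k] p) (Tribonacci.next^[k] q) := by
  induction k with
  | zero => exact h
  | succ k ih =>
    rw [Function.iterate_succ_apply', Function.iterate_succ_apply']
    convert ih.next using 1
    · push_cast; ring
    · exact_mod_cast rfl
    · rfl
    · rfl

lemma diffFormula_seven_five :
    DiffFormula (1 / 2) 0 0 0 ((3 : ℕ) : ℚ) (tribAux 5) (tribAux 4) (tribAux 3) 7 5 := by
  have h : letterCount .a 7 = 4 ∧ letterCount .a 5 = 3 ∧ letterCount .b 7 = 2 ∧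
    letterCount .b 5 = 1 ∧ letterCount .c 7 = 1 ∧ letterCount .c 5 = 1 ∧
    (shortAlmostSquares .a 7).card = 4 ∧ (shortAlmostSquares .a 5).card = 3 ∧ longCount 7 = 4 ∧
    longCount 5 = 2 ∧ (squares 7).card = 0 ∧ (squares 5).card = 0 ∧ mixedCount 7 = 2 ∧
    mixedCount 5 = 1 ∧ mixedCount' 7 = 4 ∧ mixedCount' 5 = 2 := by decide
  constructor <;> norm_num [h, tribAux]

lemma diffFormula_ten_eight :
    DiffFormula (1 / 2) (-1) 2 0 ((3 : ℕ) : ℚ) (tribAux 5) (tribAux 4) (tribAux 3) 10 8 := by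
  have h : letterCount .a 10 = 6 ∧ letterCount .a 8 = 5 ∧ letterCount .b 10 = 3 ∧
    letterCount .b 8 = 2 ∧ letterCount .c 10 = 1 ∧ letterCount .c 8 = 1 ∧
    (shortAlmostSquares .a 10).card = 5 ∧ (shortAlmostSquares .a 8).card = 4 ∧ longCount 10 = 6 ∧
    longCount 8 = 4 ∧ (squares 10).card = 2 ∧ (squares 8).card = 1 ∧ mixedCount 10 = 4 ∧
    mixedCount 8 = 3 ∧ mixedCount' 10 = 7 ∧ mixedCount' 8 = 5 := by decide
  constructor <;> norm_num [h, tribAux]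

lemma diffFormula_eight_seven :
    DiffFormula (-3 / 2) (-1) 1 2 ((2 : ℕ) : ℚ) (tribAux 4) (tribAux 3) (tribAux 2) 8 7 := by
  have h : letterCount .a 8 = 5 ∧ letterCount .a 7 = 4 ∧ letterCount .b 8 = 2 ∧
    letterCount .b 7 = 2 ∧ letterCount .c 8 = 1 ∧ letterCount .c 7 = 1 ∧
    (shortAlmostSquares .a 8).card = 4 ∧ (shortAlmostSquares .a 7).card = 4 ∧ longCount 8 = 4 ∧
    longCount 7 = 4 ∧ (squares 8).card = 1 ∧ (squares 7).card = 0 ∧ mixedCount 8 = 3 ∧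
    mixedCount 7 = 2 ∧ mixedCount' 8 = 5 ∧ mixedCount' 7 = 4 := by decide
  constructor <;> norm_num [h, tribAux]

end Tribonacci

theorem repeated_squares_partial_sums (m : ℤ) (hm : 4 ≤ m) :
    ((B ((t m + 2 * t (m - 1) + t (m - 2) - 3) / 2) : ℚ) -
        (B ((t m + 2 * t (m - 1) - t (m - 2) - 3) / 2) : ℚ) =
      (m : ℚ) / 22 * (4 * (t m : ℚ) - 9 * (t (m - 1) : ℚ) + 10 * (t (m - 2) : ℚ)) +
        1 / 44 * (19 * (t m : ℚ) + 36 * (t (m - 1) : ℚ) - 169 * (t (m - 2) : ℚ)) - 1 / 4) ∧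
    ((B ((t m + 2 * t (m - 1) - t (m - 2) - 3) / 2) : ℚ) -
        (B ((4 * t (m - 1) + t (m - 2) - t m - 3) / 2) : ℚ) =
      (m : ℚ) / 22 * (10 * (t m : ℚ) - 6 * (t (m - 1) : ℚ) - 19 * (t (m - 2) : ℚ)) +
        1 / 44 * (-189 * (t m : ℚ) + 156 * (t (m - 1) : ℚ) + 331 * (t (m - 2) : ℚ)) - 1 / 4) ∧
    ((B ((4 * t (m - 1) + t (m - 2) - t m - 3) / 2) : ℚ) -
        (B ((t m + t (m - 2) - 3) / 2) : ℚ) =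
      (m : ℚ) / 22 * (-19 * (t m : ℚ) + 29 * (t (m - 1) : ℚ) + 13 * (t (m - 2) : ℚ)) +
        1 / 44 * (237 * (t m : ℚ) - 358 * (t (m - 1) : ℚ) - 157 * (t (m - 2) : ℚ)) + 3 / 4) := by
  obtain ⟨k, rfl⟩ : ∃ k : ℕ, m = k + 4 := ⟨(m - 4).toNat, by omega⟩
  have h0 := Tribonacci.diffFormula_seven_five.iterate (k + 1)
  have h1 := Tribonacci.diffFormula_ten_eight.iterate k
  have h2 := Tribonacci.diffFormula_eight_seven.iterate k
  rw [show Tribonacci.next^[k] 10 = Tribonacci.next^[k + 1] 5 from rfl] at h1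
  have n0 := Tribonacci.two_mul_iterate_next_seven_add_three (k + 1)
  have n1 := h0.eq_add
  have n2 := h1.eq_add
  have n3 := h2.eq_add
  have s0 := h0.squares
  have s1 := h1.squares
  have s2 := h2.squares
  have e5 : tribAux (k + 5) = tribAux (k + 4) + tribAux (k + 3) + tribAux (k + 2) := rfl
  have e6 : tribAux (k + 6) = tribAux (k + 5) + tribAux (k + 4) + tribAux (k + 3) := rfl
  have t0 : t ((k : ℤ) + 4) = tribAux (k + 6) := congrArg tribAux (by omega)
  have t1 : t ((k : ℤ) + 4 - 1) = tribAux (k + 5) := congrArg tribAux (by omega)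
  have t2 : t ((k : ℤ) + 4 - 2) = tribAux (k + 4) := congrArg tribAux (by omega)
  rw [show 3 + (k + 1) = k + 4 by omega] at n1 s0
  rw [show 3 + k = k + 3 by omega] at n2 s1
  rw [show 2 + k = k + 2 by omega] at n3 s2
  simp only [add_assoc, Nat.reduceAdd] at n0 s0 s1 s2
  rw [t0, t1, t2,
    show (tribAux (k + 6) + 2 * tribAux (k + 5) + tribAux (k + 4) - 3) / 2 =
      Tribonacci.next^[k + 1] 7 by omega,
    show (tribAux (k + 6) + 2 * tribAux (k + 5) - tribAux (k + 4) - 3) / 2 =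
      Tribonacci.next^[k + 1] 5 by omega,
    show (4 * tribAux (k + 5) + tribAux (k + 4) - tribAux (k + 6) - 3) / 2 =
      Tribonacci.next^[k] 8 by omega,
    show (tribAux (k + 6) + tribAux (k + 4) - 3) / 2 = Tribonacci.next^[k] 7 by omega]
  simp only [Tribonacci.B_eq_card_squares]
  rw [e5] at e6
  rw [e6, e5] at s0
  rw [e5] at s1
  rw [e6, e5]
  push_cast at s0 s1 s2 ⊢
  refine ⟨?_, ?_, ?_⟩
  · linear_combination s0
  · linear_combination s1
  · linear_combination s2
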